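/- arXiv:2510.15833 — 6 statements merged into one kernel-verified Lean document; each statement's English description precedes it below -/
import Mathlib

section
/- Let Z be a finite set of size n, let f : Finset Z → ℝ be a monotone submodular set function with f(∅) = 0, let k ≥ 1 be a natural number with k ≤ n, and let ε ∈ (0, 1). Consider the stochastic greedy process: starting from z₀ = ∅, at each step i = 0, 1, …, k−1 one draws a random multiset R_i of s := ⌈(n/k)·ln(1/ε)⌉ elements sampled independently and uniformly at random (with replacement) from Z \ z_i, and sets z_{i+1} = z_i ∪ {x_i} where x_i is an element of R_i maximizing the marginal gain f(z_i ∪ {x}) − f(z_i). Then the expected value of f(z_k) satisfies E[f(z_k)] ≥ (1 − 1/e − ε) · max { f(A) : A ⊆ Z, |A| ≤ k }. -/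
/-- Expectation of `g` over `s` independent uniform draws (with replacement) from the
finite set `S`: each of the `|S|^s` functions `Fin s → S` is equally likely. -/
noncomputable def expDraw {α : Type*} [DecidableEq α] (s : ℕ) (S : Finset α)
    (g : (Fin s → α) → ℝ) : ℝ :=
  (∑ r : Fin s → {x // x ∈ S}, g (fun i => (r i : α))) / ((S.card : ℝ) ^ s)

/-- Expected value of `f` at the final set of the stochastic greedy process with `j`
remaining steps, starting from current set `A`.  At each step, `s` elements are drawn
independently and uniformly (with replacement) from `Z \ A`, and the element `sel A r`
(a drawn element of maximal marginal gain) is added to `A`. -/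
noncomputable def greedyExp {α : Type*} [DecidableEq α] (s : ℕ) (Z : Finset α)
    (f : Finset α → ℝ) (sel : Finset α → (Fin s → α) → α) : ℕ → Finset α → ℝ
  | 0, A => f A
  | (j + 1), A => expDraw s (Z \ A) (fun r => greedyExp s Z f sel j (insert (sel A r) A))

open Finset

/-- If `G r` dominates the weight of each of the `s` draws in `r`, then the sum of `G` is at least
the total weight of `T`, scaled by the number of draw sequences that meet `T` and divided
by `#T`: the first draw in `T` is uniform on `T`. -/
theorem card_mul_sum_draws_ge {β : Type*} [Fintype β] [DecidableEq β] (T : Finset β) (g : β → ℝ)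
    (s : ℕ) (G : (Fin s → β) → ℝ) (hG0 : ∀ r, 0 ≤ G r) (hG : ∀ r i, g (r i) ≤ G r) :
    ((Fintype.card β : ℝ) ^ s - ((Fintype.card β : ℝ) - #T) ^ s) * ∑ a ∈ T, g a ≤
      #T * ∑ r, G r := by
  induction s with
  | zero => simpa using mul_nonneg (Nat.cast_nonneg _) (hG0 _)
  | succ s ih =>
    have hsplit : ∑ r, G r = ∑ a, ∑ r : Fin s → β, G (Fin.cons a r) := by
      rw [← (Fin.consEquiv fun _ : Fin (s + 1) => β).sum_comp G, Fintype.sum_prod_type]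
      rfl
    have hT : (Fintype.card β : ℝ) ^ s * ∑ a ∈ T, g a ≤
        ∑ a ∈ T, ∑ r : Fin s → β, G (Fin.cons a r) := by
      rw [mul_sum]
      refine sum_le_sum fun a _ => ?_
      calc (Fintype.card β : ℝ) ^ s * g a = ∑ _r : Fin s → β, g a := by simp
        _ ≤ _ := sum_le_sum fun r _ => by simpa using hG (Fin.cons a r) 0
    have hTc : ((Fintype.card β : ℝ) - #T) *
        (((Fintype.card β : ℝ) ^ s - ((Fintype.card β : ℝ) - #T) ^ s) * ∑ a ∈ T, g a) ≤
        #T * ∑ a ∈ Tᶜ, ∑ r : Fin s → β, G (Fin.cons a r) := by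
      have hcard : ((Fintype.card β : ℝ) - #T) = #Tᶜ := by
        rw [card_compl, Nat.cast_sub (card_le_univ T)]
      rw [mul_sum Tᶜ]
      nth_rewrite 1 [hcard]
      rw [← nsmul_eq_mul]
      exact card_nsmul_le_sum _ _ _ fun a _ => ih _ (fun r => hG0 _)
        fun r i => by simpa using hG (Fin.cons a r) i.succ
    rw [hsplit, ← sum_add_sum_compl T, mul_add]
    have := mul_le_mul_of_nonneg_left hT (Nat.cast_nonneg (α := ℝ) #T)
    refine le_trans (le_of_eq ?_) (add_le_add this hTc)
    ring

/-- The probability that `s` draws meet a subset of size `m` is at least `(1 - ε) m / k`. -/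
theorem one_sub_mul_div_le_one_sub_pow {n k m N s : ℕ} {ε : ℝ} (hε0 : 0 < ε) (hk : 0 < k)
    (hmk : m ≤ k) (hmN : m ≤ N) (hN : 0 < N) (hNn : N ≤ n)
    (hs : (n / k : ℝ) * Real.log (1 / ε) ≤ s) :
    (1 - ε) * (m / k) ≤ 1 - (1 - (m : ℝ) / N) ^ s := by
  have hk' : (0 : ℝ) < k := by exact_mod_cast hk
  have hN' : (0 : ℝ) < N := by exact_mod_cast hN
  have hNn' : (N : ℝ) ≤ n := by exact_mod_cast hNn
  have hn' : (0 : ℝ) < n := hN'.trans_le hNn'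
  have hmk' : (m : ℝ) / k ≤ 1 := (div_le_one hk').2 (by exact_mod_cast hmk)
  have hmN' : (m : ℝ) / N ≤ 1 := (div_le_one hN').2 (by exact_mod_cast hmN)
  have hexponent : (m / k : ℝ) * Real.log (1 / ε) ≤ s * (m / N) := by
    calc (m / k : ℝ) * Real.log (1 / ε) = (m / n) * ((n / k : ℝ) * Real.log (1 / ε)) := by
          field_simp
      _ ≤ (m / n) * s := by gcongr
      _ ≤ (m / N) * s := by gcongr
      _ = s * (m / N) := mul_comm _ _
  have hpow : (1 - (m : ℝ) / N) ^ s ≤ ε ^ ((m : ℝ) / k) := by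
    calc (1 - (m : ℝ) / N) ^ s ≤ Real.exp (-((m : ℝ) / N)) ^ s :=
          pow_le_pow_left₀ (by linarith) (Real.one_sub_le_exp_neg _) _
      _ = Real.exp (-(s * (m / N))) := by rw [← Real.exp_nat_mul]; ring_nf
      _ ≤ Real.exp (Real.log ε * (m / k)) := by
          rw [one_div, Real.log_inv] at hexponent
          exact Real.exp_le_exp.2 (by linarith)
      _ = ε ^ ((m : ℝ) / k) := (Real.rpow_def_of_pos hε0 _).symm
  have hbern := rpow_one_add_le_one_add_mul_self (s := ε - 1) (by linarith)
    (p := (m : ℝ) / k) (by positivity) hmk'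
  rw [add_sub_cancel] at hbern
  linarith

section Submodular

variable {α : Type*} [DecidableEq α] {f : Finset α → ℝ}

theorem sub_le_sum_marginal_of_submodular
    (hsub : ∀ (A B : Finset α) (x : α), A ⊆ B → x ∉ B →
      f (insert x B) - f B ≤ f (insert x A) - f A)
    (A T : Finset α) (hAT : Disjoint T A) :
    f (T ∪ A) - f A ≤ ∑ a ∈ T, (f (insert a A) - f A) := by
  induction T using Finset.induction_on with
  | empty => simp
  | insert a T ha ih =>
    rw [disjoint_insert_left] at hAT
    rw [sum_insert ha, insert_union]
    have := hsub A (T ∪ A) a subset_union_right (by simp [ha, hAT.1])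
    linarith [ih hAT.2]

theorem expDraw_mono {s : ℕ} {S : Finset α} {g h : (Fin s → α) → ℝ}
    (hgh : ∀ r : Fin s → α, (∀ i, r i ∈ S) → g r ≤ h r) : expDraw s S g ≤ expDraw s S h := by
  unfold expDraw
  gcongr with r
  exact hgh _ fun i => (r i).2

theorem expDraw_affine {s : ℕ} {S : Finset α} (hS : S.Nonempty) (g : (Fin s → α) → ℝ) (c d : ℝ) :
    expDraw s S (fun r => c + d * g r) = c + d * expDraw s S g := by
  have : ((#S : ℝ) ^ s) ≠ 0 := pow_ne_zero _ (by exact_mod_cast hS.card_pos.ne')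
  unfold expDraw
  rw [sum_add_distrib, ← mul_sum]
  simp
  field_simp

/-- The expected marginal gain of one step closes a fraction `(1 - ε) / k` of the gap to any
competitor of size at most `k`. -/
theorem expDraw_gain_ge
    (hmono : ∀ A B : Finset α, A ⊆ B → f A ≤ f B)
    (hsub : ∀ (A B : Finset α) (x : α), A ⊆ B → x ∉ B →
      f (insert x B) - f B ≤ f (insert x A) - f A)
    {k s : ℕ} (hk : 0 < k) {ε : ℝ} (hε0 : 0 < ε) (hε1 : ε < 1) {Z A O : Finset α}
    (hs : ((#Z : ℝ) / k) * Real.log (1 / ε) ≤ s)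
    (hO : O ⊆ Z) (hOk : #O ≤ k) (hA : (Z \ A).Nonempty) {sel : (Fin s → α) → α}
    (hsel : ∀ r : Fin s → α, (∀ i, r i ∈ Z \ A) →
      ∀ i, f (insert (r i) A) - f A ≤ f (insert (sel r) A) - f A) :
    (1 - ε) / k * (f O - f A) ≤
      expDraw s (Z \ A) (fun r => f (insert (sel r) A) - f A) := by
  set S := Z \ A with hS
  have hN : (0 : ℝ) < #S := by exact_mod_cast hA.card_pos
  have hk' : (0 : ℝ) < k := by exact_mod_cast hk
  have hTS : O \ A ⊆ S := sdiff_subset_sdiff hO Subset.rfl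
  have hgain0 : ∀ x, 0 ≤ f (insert x A) - f A := fun x =>
    sub_nonneg.2 (hmono _ _ (subset_insert _ _))
  have hsum : f O - f A ≤ ∑ a ∈ O \ A, (f (insert a A) - f A) := by
    refine le_trans ?_ (sub_le_sum_marginal_of_submodular hsub A (O \ A) sdiff_disjoint)
    have := hmono O (O \ A ∪ A) (by simp)
    linarith
  have hkey := card_mul_sum_draws_ge ((O \ A).subtype (· ∈ S))
    (fun x => f (insert (x : α) A) - f A) s
    (fun r => f (insert (sel fun i => (r i : α)) A) - f A) (fun r => hgain0 _)
    (fun r i => hsel _ (fun i => (r i).2) i)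
  rw [sum_subtype_of_mem (fun x => f (insert x A) - f A) hTS, card_subtype,
    filter_true_of_mem hTS, Fintype.card_coe] at hkey
  have hprob := one_sub_mul_div_le_one_sub_pow hε0 hk
    ((card_le_card sdiff_subset).trans hOk) (card_le_card hTS) hA.card_pos
    (card_le_card sdiff_subset) hs
  unfold expDraw
  rw [le_div_iff₀ (pow_pos hN s)]
  rcases (O \ A).eq_empty_or_nonempty with hT | hT
  · rw [hT, sum_empty] at hsum
    refine le_trans ?_ (sum_nonneg fun r _ => hgain0 _)
    exact mul_nonpos_of_nonpos_of_nonneg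
      (mul_nonpos_of_nonneg_of_nonpos (div_nonneg (by linarith) hk'.le) hsum) (by positivity)
  · have hm : (0 : ℝ) < #(O \ A) := by exact_mod_cast hT.card_pos
    have hfrac : (1 - (#(O \ A) : ℝ) / #S) ^ s * (#S : ℝ) ^ s = (#S - #(O \ A) : ℝ) ^ s := by
      rw [← mul_pow]
      congr 1
      field_simp
    refine le_of_mul_le_mul_left (le_trans ?_ hkey) hm
    calc (#(O \ A) : ℝ) * ((1 - ε) / k * (f O - f A) * (#S : ℝ) ^ s)
        = ((1 - ε) * (#(O \ A) / k)) * (#S : ℝ) ^ s * (f O - f A) := by ring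
      _ ≤ ((1 - ε) * (#(O \ A) / k)) * (#S : ℝ) ^ s * ∑ a ∈ O \ A, (f (insert a A) - f A) := by
          have : 0 ≤ 1 - ε := by linarith
          gcongr
      _ ≤ (1 - (1 - (#(O \ A) : ℝ) / #S) ^ s) * (#S : ℝ) ^ s *
            ∑ a ∈ O \ A, (f (insert a A) - f A) := by
          have := sum_nonneg fun a (_ : a ∈ O \ A) => hgain0 a
          gcongr
      _ = _ := by rw [sub_mul, hfrac, one_mul]

theorem greedyExp_ge {s : ℕ} {Z : Finset α} {sel : Finset α → (Fin s → α) → α} {c M : ℝ}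
    (hc : c ≤ 1)
    (hselmem : ∀ (A : Finset α) (r : Fin s → α), (∀ i, r i ∈ Z \ A) → ∃ i, sel A r = r i)
    (hgain : ∀ A, (Z \ A).Nonempty →
      c * (M - f A) ≤ expDraw s (Z \ A) (fun r => f (insert (sel A r) A) - f A))
    (j : ℕ) (A : Finset α) (hAZ : A ⊆ Z) (hj : #A + j ≤ #Z) :
    M - (1 - c) ^ j * (M - f A) ≤ greedyExp s Z f sel j A := by
  induction j generalizing A with
  | zero => simp [greedyExp]
  | succ j ih =>
    have hne : (Z \ A).Nonempty := by
      rw [← card_pos, card_sdiff_of_subset hAZ]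
      omega
    have hpow : 0 ≤ (1 - c) ^ j := pow_nonneg (by linarith) _
    calc M - (1 - c) ^ (j + 1) * (M - f A)
        = M - (1 - c) ^ j * (M - f A) + (1 - c) ^ j * (c * (M - f A)) := by ring
      _ ≤ M - (1 - c) ^ j * (M - f A) + (1 - c) ^ j *
            expDraw s (Z \ A) (fun r => f (insert (sel A r) A) - f A) := by
          gcongr
          exact hgain A hne
      _ = expDraw s (Z \ A) (fun r => M - (1 - c) ^ j * (M - f A) +
            (1 - c) ^ j * (f (insert (sel A r) A) - f A)) := (expDraw_affine hne _ _ _).symm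
      _ ≤ greedyExp s Z f sel (j + 1) A := by
          refine expDraw_mono fun r hr => ?_
          obtain ⟨i, hi⟩ := hselmem A r hr
          have hmem := mem_sdiff.1 (hr i)
          rw [← hi] at hmem
          refine le_trans (le_of_eq ?_) (ih (insert (sel A r) A)
            (insert_subset hmem.1 hAZ) (by rw [card_insert_of_notMem hmem.2]; omega))
          ring

end Submodular

theorem one_sub_div_pow_le {k : ℕ} (hk : 0 < k) {ε : ℝ} (hε0 : 0 < ε) (hε1 : ε < 1) :
    (1 - (1 - ε) / k) ^ k ≤ 1 / Real.exp 1 + ε := by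
  have hk' : (1 : ℝ) ≤ k := by exact_mod_cast hk
  calc (1 - (1 - ε) / k) ^ k ≤ Real.exp (-(1 - ε)) :=
        Real.one_sub_div_pow_le_exp_neg (by linarith)
    _ ≤ 1 / Real.exp 1 + ε := by
        have h1 : Real.exp (-(1 - ε)) * Real.exp (-ε) = 1 / Real.exp 1 := by
          rw [← Real.exp_add, one_div, ← Real.exp_neg]
          ring_nf
        have h2 := Real.one_sub_le_exp_neg ε
        have h3 : Real.exp (-(1 - ε)) ≤ 1 := Real.exp_le_one_iff.2 (by linarith)
        have h4 := mul_le_mul_of_nonneg_left h2 (Real.exp_pos (-(1 - ε))).le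
        nlinarith

/-- Stochastic greedy guarantee: for a monotone submodular `f` with `f ∅ = 0` on a
ground set `Z` of size `n`, `1 ≤ k ≤ n`, `ε ∈ (0,1)` and `s = ⌈(n/k)·ln(1/ε)⌉`
uniform draws (with replacement) from `Z \ zᵢ` at each step, adding a drawn element of
maximal marginal gain, the expected value of `f` at the resulting `k`-step set is at
least `(1 − 1/e − ε) · max {f A : A ⊆ Z, |A| ≤ k}`. -/
theorem stmt0 {α : Type*} [DecidableEq α] (Z : Finset α) (n : ℕ) (hn : Z.card = n)
    (f : Finset α → ℝ) (hf0 : f ∅ = 0)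
    (hmono : ∀ A B : Finset α, A ⊆ B → f A ≤ f B)
    (hsub : ∀ (A B : Finset α) (x : α), A ⊆ B → x ∉ B →
      f (insert x B) - f B ≤ f (insert x A) - f A)
    (k : ℕ) (hk1 : 1 ≤ k) (hkn : k ≤ n)
    (ε : ℝ) (hε0 : 0 < ε) (hε1 : ε < 1)
    (s : ℕ) (hs : s = ⌈(n / k : ℝ) * Real.log (1 / ε)⌉₊)
    (sel : Finset α → (Fin s → α) → α)
    (hselmem : ∀ (A : Finset α) (r : Fin s → α), (∀ i, r i ∈ Z \ A) → ∃ i, sel A r = r i)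
    (hselmax : ∀ (A : Finset α) (r : Fin s → α), (∀ i, r i ∈ Z \ A) →
      ∀ i, f (insert (r i) A) - f A ≤ f (insert (sel A r) A) - f A) :
    greedyExp s Z f sel k ∅ ≥
      (1 - 1 / Real.exp 1 - ε) *
        (Z.powerset.filter (fun A => A.card ≤ k)).sup' ⟨∅, by simp⟩ f := by
  obtain ⟨O, hOmem, hO⟩ := exists_mem_eq_sup'
    (s := Z.powerset.filter (fun A => A.card ≤ k)) ⟨∅, by simp⟩ f
  rw [hO]
  rw [mem_filter, mem_powerset] at hOmem
  subst hn
  have hk' : (1 : ℝ) ≤ k := by exact_mod_cast hk1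
  have hs' : ((#Z : ℝ) / k) * Real.log (1 / ε) ≤ s := hs ▸ Nat.le_ceil _
  have hc : (1 - ε) / k ≤ 1 := (div_le_one (by linarith)).2 (by linarith)
  have hgreedy := greedyExp_ge (f := f) (M := f O) hc hselmem
    (fun A hA => expDraw_gain_ge hmono hsub hk1 hε0 hε1 hs' hOmem.1 hOmem.2 hA (hselmax A))
    k ∅ (empty_subset _) (by simpa using hkn)
  have hO0 : 0 ≤ f O := hf0 ▸ hmono ∅ O (empty_subset _)
  have hpow := mul_le_mul_of_nonneg_right (one_sub_div_pow_le hk1 hε0 hε1) hO0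
  rw [hf0, sub_zero] at hgreedy
  linarith
end

section
/- Let n and k be positive integers with k ≤ n, let ε ∈ (0, 1), and set s := (n/k)·ln(1/ε) (any real s with s ≥ (n/k)·ln(1/ε) suffices). Let S be a finite nonempty set with |S| ≤ n, let T ⊆ S be a subset with 0 < |T| ≤ k, and let R be a multiset of ⌈s⌉ elements drawn independently and uniformly at random (with replacement) from S. Then P(R ∩ T ≠ ∅) ≥ (1 − ε) · |T| / k. -/
/-- The number of functions `ι → S` hitting `T` is `|S|^|ι| - |Tᶜ|^|ι|`. -/
theorem card_filter_exists_mem_add_card_compl_pow {ι S : Type*} [Fintype ι] [DecidableEq ι]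
    [Fintype S] [DecidableEq S] (T : Finset S)
    [DecidablePred fun r : ι → S => ∃ i, r i ∈ T] :
    (Finset.univ.filter (fun r : ι → S => ∃ i, r i ∈ T)).card + Tᶜ.card ^ Fintype.card ι =
      Fintype.card S ^ Fintype.card ι := by
  have hcompl : Finset.univ.filter (fun r : ι → S => ¬ ∃ i, r i ∈ T) =
      Fintype.piFinset (fun _ => Tᶜ) := by
    ext r
    simp
  have hsplit := Finset.card_filter_add_card_filter_not (s := Finset.univ)
    (fun r : ι → S => ∃ i, r i ∈ T)
  rw [hcompl] at hsplit
  simpa using hsplit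

/-- The chord inequality for the convex function `t ↦ ε ^ t` on `[0, 1]`. -/
theorem rpow_le_one_sub_mul_one_sub {ε t : ℝ} (hε : 0 ≤ ε) (ht0 : 0 ≤ t) (ht1 : t ≤ 1) :
    ε ^ t ≤ 1 - (1 - ε) * t := by
  have h := Real.geom_mean_le_arith_mean2_weighted ht0 (sub_nonneg.2 ht1) hε zero_le_one
    (add_sub_cancel t 1)
  rw [Real.one_rpow] at h
  linarith

/-- Let `1 ≤ k ≤ n`, `ε ∈ (0,1)` and `s ≥ (n/k)·ln(1/ε)`.  If `R` is a multiset of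
`⌈s⌉` elements drawn independently and uniformly (with replacement) from a finite
nonempty set `S` with `|S| ≤ n`, and `T ⊆ S` satisfies `0 < |T| ≤ k`, then
`P(R ∩ T ≠ ∅) ≥ (1 - ε)·|T|/k`.  The sample `R` is modeled as a function
`Fin ⌈s⌉ → S`, each of the `|S|^⌈s⌉` such functions being equally likely. -/
theorem stmt3 {S : Type*} [Fintype S] [DecidableEq S] [Nonempty S]
    (n k : ℕ) (hn : 0 < n) (hk : 0 < k) (hkn : k ≤ n)
    (ε : ℝ) (hε0 : 0 < ε) (hε1 : ε < 1)
    (s : ℝ) (hs : (n / k : ℝ) * Real.log (1 / ε) ≤ s)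
    (hcard : Fintype.card S ≤ n)
    (T : Finset S) (hT0 : 0 < T.card) (hTk : T.card ≤ k) :
    (1 - ε) * T.card / k ≤
      ((Finset.univ.filter (fun r : Fin ⌈s⌉₊ → S => ∃ i, r i ∈ T)).card : ℝ) /
        ((Fintype.card S : ℝ) ^ ⌈s⌉₊) := by
  set m := ⌈s⌉₊
  have hkR : (0 : ℝ) < k := by exact_mod_cast hk
  have hnR : (0 : ℝ) < n := by exact_mod_cast hn
  have hcR : (0 : ℝ) < Fintype.card S := by exact_mod_cast Fintype.card_pos
  have hcn : (Fintype.card S : ℝ) ≤ n := by exact_mod_cast hcard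
  have hcount : ((Finset.univ.filter (fun r : Fin m → S => ∃ i, r i ∈ T)).card : ℝ) +
      (Tᶜ.card : ℝ) ^ m = (Fintype.card S : ℝ) ^ m := by
    have h := card_filter_exists_mem_add_card_compl_pow (ι := Fin m) T
    rw [Fintype.card_fin] at h
    exact_mod_cast h
  have hcompl : (Tᶜ.card : ℝ) = Fintype.card S - T.card := by
    rw [Finset.card_compl, Nat.cast_sub (Finset.card_le_univ T)]
  have hms : (n / k : ℝ) * Real.log (1 / ε) ≤ m := hs.trans (Nat.le_ceil s)
  have hbase : (Tᶜ.card : ℝ) / Fintype.card S ≤ Real.exp (-(T.card / n)) := by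
    have h₁ : (T.card : ℝ) / n ≤ T.card / Fintype.card S := by gcongr
    have h₂ := Real.add_one_le_exp (-(T.card / n : ℝ))
    rw [hcompl, sub_div, div_self hcR.ne']
    linarith
  have hmiss : ((Tᶜ.card : ℝ) / Fintype.card S) ^ m ≤ ε ^ (T.card / k : ℝ) := by
    refine (pow_le_pow_left₀ (by positivity) hbase m).trans ?_
    rw [← Real.exp_nat_mul, Real.rpow_def_of_pos hε0, Real.exp_le_exp]
    have h := mul_le_mul_of_nonneg_right hms (by positivity : (0 : ℝ) ≤ T.card / n)
    have heq : (n / k : ℝ) * Real.log (1 / ε) * (T.card / n) =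
        -(Real.log ε * (T.card / k)) := by
      rw [one_div, Real.log_inv]
      field_simp
    linarith
  have hchord := rpow_le_one_sub_mul_one_sub hε0.le (by positivity : (0 : ℝ) ≤ T.card / k)
    ((div_le_one hkR).2 (by exact_mod_cast hTk))
  rw [eq_sub_of_add_eq hcount, sub_div, div_self (by positivity), ← div_pow, mul_div_assoc]
  linarith
end

section
/- Let S be a finite nonempty set, let g : S → ℝ be a nonnegative function, let T ⊆ S be a nonempty subset, and let R be a multiset of s ≥ 1 elements drawn independently and uniformly at random (with replacement) from S. Then the expected value of max_{z ∈ R} g(z) satisfies E[max_{z ∈ R} g(z)] ≥ P(R ∩ T ≠ ∅) · (1/|T|) · Σ_{z ∈ T} g(z). -/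
open Finset in
/-- A uniformly random tuple that meets `T` has an entry, chosen from the set of positions at which
it meets `T`, that is uniformly distributed on `T`. -/
theorem exists_uniform_hit {ι S : Type*} [Fintype ι] [DecidableEq ι] [Nonempty ι] [Fintype S]
    [DecidableEq S] (T : Finset S) :
    ∃ f : (ι → S) → ι,
      (∀ r : ι → S, (∃ i, r i ∈ T) → r (f r) ∈ T) ∧
      ∀ z ∈ T, T.card * (univ.filter fun r : ι → S => (∃ i, r i ∈ T) ∧ r (f r) = z).card =
        (univ.filter fun r : ι → S => ∃ i, r i ∈ T).card := by
  classical
  have hchoice : ∀ A : Finset ι, ∃ i, A.Nonempty → i ∈ A := fun A => by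
    by_cases hA : A.Nonempty
    · exact ⟨hA.choose, fun _ => hA.choose_spec⟩
    · exact ⟨Classical.arbitrary ι, fun h => absurd h hA⟩
  choose idx hidx using hchoice
  have hmem : ∀ r : ι → S, (∃ i, r i ∈ T) → r (idx (univ.filter fun i => r i ∈ T)) ∈ T := by
    rintro r ⟨i, hi⟩
    exact (mem_filter.1 (hidx (univ.filter fun i => r i ∈ T) ⟨i, by simpa using hi⟩)).2
  refine ⟨fun r => idx (univ.filter fun i => r i ∈ T), hmem, fun z hz => ?_⟩
  have hfiber : ∀ w ∈ T,
      (univ.filter fun r : ι → S =>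
        (∃ i, r i ∈ T) ∧ r (idx (univ.filter fun i => r i ∈ T)) = w).card =
      (univ.filter fun r : ι → S =>
        (∃ i, r i ∈ T) ∧ r (idx (univ.filter fun i => r i ∈ T)) = z).card := by
    intro w hw
    have hswap : ∀ x, Equiv.swap w z x ∈ T ↔ x ∈ T := fun x => by
      rw [Equiv.swap_apply_def]
      split_ifs with h₁ h₂ <;> simp_all
    refine card_equiv (Equiv.piCongrRight fun _ => Equiv.swap w z) fun r => ?_
    simp [hswap, Equiv.swap_apply_eq_iff]
  rw [card_eq_sum_card_fiberwise (s := univ.filter fun r : ι → S => ∃ i, r i ∈ T) (t := T)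
    (f := fun r => r (idx (univ.filter fun i => r i ∈ T)))
    fun r hr => hmem r (by simpa using hr)]
  simp only [filter_filter]
  rw [sum_congr rfl hfiber, sum_const, smul_eq_mul]

/-- Let `g : S → ℝ` be nonnegative on a finite nonempty set `S`, let `T ⊆ S` be
nonempty, and let `R` be a multiset of `s ≥ 1` elements drawn independently and
uniformly (with replacement) from `S`.  Then
`E[max_{z ∈ R} g z] ≥ P(R ∩ T ≠ ∅) · (1/|T|) · ∑_{z ∈ T} g z`.
The sample `R` is modeled as a function `Fin s → S`, each of the `|S|^s` such
functions being equally likely. -/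
theorem stmt4 {S : Type*} [Fintype S] [DecidableEq S] [Nonempty S]
    (g : S → ℝ) (hg : ∀ z, 0 ≤ g z)
    (T : Finset S) (hT : T.Nonempty)
    (s : ℕ) (hs : 1 ≤ s) :
    (∑ r : Fin s → S,
        (Finset.univ.sup' ⟨⟨0, hs⟩, Finset.mem_univ _⟩ (fun i : Fin s => g (r i)))) /
        ((Fintype.card S : ℝ) ^ s)
      ≥ (((Finset.univ.filter (fun r : Fin s → S => ∃ i, r i ∈ T)).card : ℝ) /
            ((Fintype.card S : ℝ) ^ s)) *
          ((1 / (T.card : ℝ)) * ∑ z ∈ T, g z) := by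
  have : Nonempty (Fin s) := ⟨⟨0, hs⟩⟩
  obtain ⟨f, hfT, hcard⟩ := exists_uniform_hit (ι := Fin s) T
  have hTpos : (0 : ℝ) < T.card := by exact_mod_cast hT.card_pos
  have hle_sup : ∀ (r : Fin s → S) (i : Fin s),
      g (r i) ≤ Finset.univ.sup' ⟨⟨0, hs⟩, Finset.mem_univ _⟩ (fun i : Fin s => g (r i)) :=
    fun r i => Finset.le_sup' (fun i : Fin s => g (r i)) (Finset.mem_univ i)
  have hsum : ∑ r ∈ Finset.univ.filter (fun r : Fin s → S => ∃ i, r i ∈ T), g (r (f r)) =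
      ((Finset.univ.filter (fun r : Fin s → S => ∃ i, r i ∈ T)).card : ℝ) *
        ((1 / (T.card : ℝ)) * ∑ z ∈ T, g z) := by
    rw [← Finset.sum_fiberwise_of_maps_to (t := T) (g := fun r => r (f r))
      fun r hr => hfT r (by simpa using hr), Finset.mul_sum, Finset.mul_sum]
    refine Finset.sum_congr rfl fun z hz => ?_
    rw [Finset.filter_filter, Finset.sum_congr rfl
      (fun r hr => congrArg g (Finset.mem_filter.1 hr).2.2), Finset.sum_const, nsmul_eq_mul]
    have hnat : T.card * (Finset.univ.filter fun r : Fin s → S =>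
        (∃ i, r i ∈ T) ∧ r (f r) = z).card =
        (Finset.univ.filter fun r : Fin s → S => ∃ i, r i ∈ T).card := by
      convert hcard z hz
    rw [← hnat, Nat.cast_mul]
    field_simp
  rw [ge_iff_le, div_mul_eq_mul_div, ← hsum]
  refine div_le_div_of_nonneg_right ?_ (by positivity)
  calc _ ≤ ∑ r : Fin s → S, g (r (f r)) :=
        Finset.sum_le_sum_of_subset_of_nonneg (Finset.filter_subset _ _) fun r _ _ => hg _
    _ ≤ _ := Finset.sum_le_sum fun r _ => hle_sup r (f r)
end

section
/- Let V be a finite index set, let K be a real positive semidefinite matrix indexed by V × V, and let γ > 0. Define Inf(A) := (1/2) · log det( I + γ^{−2} · K[A] ) for A ⊆ V, where K[A] is the principal submatrix of K indexed by A and I is the identity matrix of size |A|. Then Inf is monotone: for all A ⊆ B ⊆ V, Inf(A) ≤ Inf(B). -/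
/-- The information gain `Inf(A) = (1/2)·log det(I + γ⁻²·K[A])`, where `K[A]` is the
principal submatrix of `K` indexed by `A`. -/
noncomputable def infGain {V : Type*} [Fintype V] [DecidableEq V]
    (K : Matrix V V ℝ) (γ : ℝ) (A : Finset V) : ℝ :=
  (1 / 2) * Real.log
    (Matrix.det
      ((1 : Matrix {x // x ∈ A} {x // x ∈ A} ℝ) +
        (γ ^ 2)⁻¹ •
          K.submatrix (fun a : {x // x ∈ A} => (a : V)) (fun a : {x // x ∈ A} => (a : V))))

theorem Matrix.PosSemidef.one_le_det_one_add {n : Type*} [Fintype n] [DecidableEq n]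
    {T : Matrix n n ℝ} (hT : T.PosSemidef) : 1 ≤ (1 + T).det := by
  have hH : (1 + T).IsHermitian := Matrix.isHermitian_one.add hT.1
  rw [hH.det_eq_prod_eigenvalues]
  refine Finset.one_le_prod fun i _ => ?_
  have h := hT.re_dotProduct_nonneg (hH.eigenvectorBasis i)
  have h1 : star ⇑(hH.eigenvectorBasis i) ⬝ᵥ ⇑(hH.eigenvectorBasis i) = 1 := by
    have := hH.eigenvectorBasis.inner_eq_one i
    rwa [EuclideanSpace.inner_eq_star_dotProduct, dotProduct_comm] at this
  rw [RCLike.ofReal_real_eq_id, id, hH.eigenvalues_eq, Matrix.add_mulVec, Matrix.one_mulVec,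
    dotProduct_add, map_add, h1]
  simpa using h

open scoped Matrix in
theorem Matrix.PosSemidef.det_one_add_toBlocks₁₁_le {m n : Type*} [Fintype m] [Fintype n]
    [DecidableEq m] [DecidableEq n] {S : Matrix (m ⊕ n) (m ⊕ n) ℝ} (hS : S.PosSemidef) :
    (1 + S.toBlocks₁₁).det ≤ (1 + S).det := by
  have hP : (1 + S.toBlocks₁₁).PosDef := Matrix.PosDef.one.add_posSemidef (hS.submatrix Sum.inl)
  have hQ : S.toBlocks₂₁ = S.toBlocks₁₂ᴴ := by
    ext i j
    exact (hS.1.apply _ _).symm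
  let := hP.isUnit.invertible
  have hN : (Matrix.fromBlocks (1 + S.toBlocks₁₁) S.toBlocks₁₂ S.toBlocks₁₂ᴴ
      S.toBlocks₂₂).PosSemidef := by
    have hD : (Matrix.diagonal (Sum.elim 1 0 : m ⊕ n → ℝ)).PosSemidef :=
      Matrix.PosSemidef.diagonal fun i => by cases i <;> simp
    convert! hD.add hS using 1
    conv_rhs => rw [← Matrix.fromBlocks_toBlocks S, hQ]
    rw [← Matrix.fromBlocks_diagonal, Matrix.fromBlocks_add]
    simp
  have hT := (Matrix.PosDef.fromBlocks₁₁ _ _ hP).1 hN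
  have hdet : (1 + S).det = (1 + S.toBlocks₁₁).det *
      (1 + (S.toBlocks₂₂ - S.toBlocks₁₂ᴴ * (1 + S.toBlocks₁₁)⁻¹ * S.toBlocks₁₂)).det := by
    conv_lhs => rw [← Matrix.fromBlocks_toBlocks S, hQ, ← Matrix.fromBlocks_one,
      Matrix.fromBlocks_add, zero_add, zero_add, Matrix.det_fromBlocks₁₁,
      Matrix.invOf_eq_nonsing_inv, add_sub_assoc]
  rw [hdet]
  exact le_mul_of_one_le_right hP.det_pos.le hT.one_le_det_one_add

/-- For a positive semidefinite kernel matrix `K` and noise level `γ > 0`, the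
information gain `A ↦ (1/2)·log det(I + γ⁻²·K[A])` is monotone. -/
theorem stmt8 {V : Type*} [Fintype V] [DecidableEq V]
    (K : Matrix V V ℝ) (hK : K.PosSemidef) (γ : ℝ) (hγ : 0 < γ)
    (A B : Finset V) (hAB : A ⊆ B) :
    infGain K γ A ≤ infGain K γ B := by
  obtain ⟨C, hC, rfl⟩ : ∃ C, Disjoint A C ∧ A ∪ C = B :=
    ⟨B \ A, Finset.disjoint_sdiff, Finset.union_sdiff_of_subset hAB⟩
  have hS : ((γ ^ 2)⁻¹ • K).PosSemidef := hK.smul (by positivity)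
  have hpos : 0 < (1 + ((γ ^ 2)⁻¹ • K).submatrix (fun a : {x // x ∈ A} => (a : V))
      (fun a : {x // x ∈ A} => (a : V))).det :=
    (Matrix.PosDef.one.add_posSemidef (hS.submatrix _)).det_pos
  let e := Equiv.Finset.union A C hC
  have hle := (hS.submatrix fun i => (e i : V)).det_one_add_toBlocks₁₁_le
  have hdet : (1 + ((γ ^ 2)⁻¹ • K).submatrix (fun i => (e i : V)) (fun i => (e i : V))).det =
      (1 + ((γ ^ 2)⁻¹ • K).submatrix (fun a : {x // x ∈ A ∪ C} => (a : V))
        (fun a : {x // x ∈ A ∪ C} => (a : V))).det := by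
    rw [← Matrix.det_submatrix_equiv_self e (1 + _), Matrix.submatrix_add, Pi.add_apply,
      Pi.add_apply, Matrix.submatrix_one_equiv, Matrix.submatrix_submatrix]
    rfl
  rw [hdet] at hle
  exact mul_le_mul_of_nonneg_left (Real.log_le_log hpos hle) (by norm_num)
end

section
/- Let V be a finite index set, let K be a real positive semidefinite matrix indexed by V × V, and let γ > 0. Define Inf(A) := (1/2) · log det( I + γ^{−2} · K[A] ) for A ⊆ V, where K[A] is the principal submatrix of K indexed by A and I is the identity matrix of size |A|. Then Inf is submodular: for all A ⊆ B ⊆ V and every x ∈ V with x ∉ B, Inf(A ∪ {x}) − Inf(A) ≥ Inf(B ∪ {x}) − Inf(B). -/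
open Matrix in
/-- The Schur complement of the top left block of a positive definite matrix with a bottom right
block of size one is the minimum of the quadratic form over vectors with last coordinate `1`. -/
theorem Matrix.PosDef.isLeast_det_div_det_toBlocks₁₁ {m : Type*} [Fintype m] [DecidableEq m]
    {P : Matrix (m ⊕ Unit) (m ⊕ Unit) ℝ} (hP : P.PosDef) :
    IsLeast ((fun u => u ⬝ᵥ P *ᵥ u) '' {u | u (Sum.inr ()) = 1})
      (P.det / P.toBlocks₁₁.det) := by
  have hA : P.toBlocks₁₁.PosDef := hP.submatrix Sum.inl_injective
  let _ : Invertible P.toBlocks₁₁ := hA.isUnit.invertible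
  have hC : P.toBlocks₂₁ = P.toBlocks₁₂ᴴ := by
    ext i j
    simpa [toBlocks₂₁, toBlocks₁₂] using (hP.isHermitian.apply (Sum.inr i) (Sum.inl j)).symm
  have hB : P = fromBlocks P.toBlocks₁₁ P.toBlocks₁₂ P.toBlocks₁₂ᴴ P.toBlocks₂₂ := by
    rw [← hC, fromBlocks_toBlocks]
  have hdet : P.det / P.toBlocks₁₁.det =
      (P.toBlocks₂₂ - P.toBlocks₁₂ᴴ * P.toBlocks₁₁⁻¹ * P.toBlocks₁₂) () () := by
    have h := congrArg det hB
    rw [det_fromBlocks₁₁, invOf_eq_nonsing_inv, det_unique (n := Unit)] at h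
    rw [h, mul_div_cancel_left₀ _ hA.det_pos.ne']
  have hquad (a : m → ℝ) :
      (a ⊕ᵥ fun _ : Unit => (1 : ℝ)) ⬝ᵥ P *ᵥ (a ⊕ᵥ fun _ => 1) =
        (a + (P.toBlocks₁₁⁻¹ * P.toBlocks₁₂) *ᵥ fun _ => 1) ⬝ᵥ
          P.toBlocks₁₁ *ᵥ (a + (P.toBlocks₁₁⁻¹ * P.toBlocks₁₂) *ᵥ fun _ => 1) +
        P.det / P.toBlocks₁₁.det := by
    have h := schur_complement_eq₁₁ P.toBlocks₁₂ P.toBlocks₂₂ a (fun _ => 1) hA.isHermitian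
    rw [← hB, ← dotProduct_mulVec, ← dotProduct_mulVec, ← dotProduct_mulVec] at h
    rw [hdet]
    simpa [dotProduct, mulVec] using h
  refine ⟨⟨(-((P.toBlocks₁₁⁻¹ * P.toBlocks₁₂) *ᵥ fun _ => 1)) ⊕ᵥ fun _ => 1, rfl, ?_⟩, ?_⟩
  · simp [hquad]
  · rintro _ ⟨u, hu, rfl⟩
    have hu' : u = (fun i => u (Sum.inl i)) ⊕ᵥ fun _ => 1 := by
      ext (i | i)
      · rfl
      · exact hu
    beta_reduce
    rw [hu', hquad]
    exact le_add_of_nonneg_left (hA.posSemidef.dotProduct_mulVec_nonneg _)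

open Matrix in
/-- The quadratic form of a principal submatrix is the restriction of the full quadratic form to
vectors supported on the chosen indices. -/
theorem Matrix.dotProduct_submatrix_mulVec_comp {ι V : Type*} [Fintype ι] [Fintype V]
    (M : Matrix V V ℝ) {f : ι → V} (hf : Function.Injective f) {v : V → ℝ}
    (hv : ∀ i ∉ Set.range f, v i = 0) :
    (v ∘ f) ⬝ᵥ M.submatrix f f *ᵥ (v ∘ f) = v ⬝ᵥ M *ᵥ v := by
  refine Fintype.sum_of_injective f hf _ _ (fun i hi => by simp [hv i hi]) fun i => ?_
  refine congrArg (v (f i) * ·) ?_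
  exact Fintype.sum_of_injective f hf _ _ (fun j hj => by simp [hv j hj]) fun j => rfl

open Matrix in
/-- The ratio of the principal minors on `insert x S` and `S` of a positive definite matrix is the
minimum of its quadratic form over vectors supported on `insert x S` with coordinate `1` at `x`. -/
theorem Matrix.PosDef.isLeast_det_submatrix_insert_div {V : Type*} [Fintype V] [DecidableEq V]
    {M : Matrix V V ℝ} (hM : M.PosDef) {S : Finset V} {x : V} (hx : x ∉ S) :
    IsLeast ((fun v => v ⬝ᵥ M *ᵥ v) '' {v | v x = 1 ∧ ∀ i ∉ insert x S, v i = 0})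
      ((M.submatrix (Subtype.val : {i // i ∈ insert x S} → V) Subtype.val).det /
        (M.submatrix (Subtype.val : {i // i ∈ S} → V) Subtype.val).det) := by
  let e : {i // i ∈ S} ⊕ Unit ≃ {i // i ∈ insert x S} :=
    (Equiv.optionEquivSumPUnit _).symm.trans (Finset.subtypeInsertEquivOption hx).symm
  let f : {i // i ∈ S} ⊕ Unit → V := fun i => e i
  have hf : Function.Injective f := Subtype.val_injective.comp e.injective
  have hrange (i : V) : i ∈ Set.range f ↔ i ∈ insert x S := by
    refine ⟨?_, fun hi => ⟨e.symm ⟨i, hi⟩, by simp [f]⟩⟩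
    rintro ⟨j, rfl⟩
    exact (e j).2
  have hdet : (M.submatrix (Subtype.val : {i // i ∈ insert x S} → V) Subtype.val).det =
      (M.submatrix f f).det :=
    (det_submatrix_equiv_self e _).symm
  have himage : (fun v => v ⬝ᵥ M *ᵥ v) '' {v | v x = 1 ∧ ∀ i ∉ insert x S, v i = 0} =
      (fun u => u ⬝ᵥ M.submatrix f f *ᵥ u) '' {u | u (Sum.inr ()) = 1} := by
    ext r
    constructor
    · rintro ⟨v, ⟨hvx, hv⟩, rfl⟩
      exact ⟨v ∘ f, hvx, M.dotProduct_submatrix_mulVec_comp hf fun i hi =>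
        hv i (mt (hrange i).2 hi)⟩
    · rintro ⟨u, hu, rfl⟩
      have hcomp : Function.extend f u (0 : V → ℝ) ∘ f = u := Function.extend_comp hf u _
      have hzero (i : V) (hi : i ∉ Set.range f) : Function.extend f u (0 : V → ℝ) i = 0 :=
        Function.extend_apply' u _ i hi
      refine ⟨Function.extend f u (0 : V → ℝ), ⟨?_, fun i hi => hzero i (mt (hrange i).1 hi)⟩, ?_⟩
      · exact (congrFun hcomp (Sum.inr ())).trans hu
      · beta_reduce
        rw [← M.dotProduct_submatrix_mulVec_comp hf hzero, hcomp]
  rw [hdet, himage]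
  exact (hM.submatrix hf).isLeast_det_div_det_toBlocks₁₁

/-- For a positive semidefinite kernel matrix `K` and noise level `γ > 0`, the
information gain `A ↦ (1/2)·log det(I + γ⁻²·K[A])` is submodular: for `A ⊆ B` and
`x ∉ B`, `Inf(A ∪ {x}) − Inf(A) ≥ Inf(B ∪ {x}) − Inf(B)`. -/
theorem stmt9 {V : Type*} [Fintype V] [DecidableEq V]
    (K : Matrix V V ℝ) (hK : K.PosSemidef) (γ : ℝ) (hγ : 0 < γ)
    (A B : Finset V) (hAB : A ⊆ B) (x : V) (hx : x ∉ B) :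
    infGain K γ (insert x B) - infGain K γ B ≤
      infGain K γ (insert x A) - infGain K γ A := by
  have hM : (1 + (γ ^ 2)⁻¹ • K).PosDef :=
    Matrix.PosDef.one.add_posSemidef (hK.smul (by positivity))
  have hInf (S : Finset V) : infGain K γ S = 1 / 2 * Real.log
      ((1 + (γ ^ 2)⁻¹ • K).submatrix (Subtype.val : {i // i ∈ S} → V) Subtype.val).det := by
    rw [infGain, ← Matrix.submatrix_one (Subtype.val : {i // i ∈ S} → V) Subtype.val_injective]
    rfl
  have hpos (S : Finset V) : 0 < ((1 + (γ ^ 2)⁻¹ • K).submatrix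
      (Subtype.val : {i // i ∈ S} → V) Subtype.val).det :=
    (hM.submatrix Subtype.val_injective).det_pos
  have hle := (hM.isLeast_det_submatrix_insert_div (mt (@hAB x) hx)).mono
    (hM.isLeast_det_submatrix_insert_div hx)
    (Set.image_mono fun v hv => ⟨hv.1, fun i hi =>
      hv.2 i (mt (@Finset.insert_subset_insert _ _ x _ _ hAB i) hi)⟩)
  have hlog := Real.log_le_log (div_pos (hpos _) (hpos _)) hle
  rw [Real.log_div (hpos _).ne' (hpos _).ne', Real.log_div (hpos _).ne' (hpos _).ne'] at hlog
  simp only [hInf]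
  linarith
end

section
/- Let Z be a finite set with |Z| = n, let f : Finset Z → ℝ be a monotone submodular set function, let k ≥ 1 be a natural number with k ≤ n, let ε ∈ (0, 1), and let A* ⊆ Z with |A*| ≤ k. Fix a current set A ⊆ Z, and let R be a multiset of ⌈(n/k)·ln(1/ε)⌉ elements drawn independently and uniformly at random (with replacement) from Z \ A, where Z \ A is nonempty and A* \ A is nonempty. Let x be an element of R maximizing the marginal gain f(A ∪ {x}) − f(A). Then E[ f(A ∪ {x}) − f(A) ] ≥ ((1 − ε)/k) · ( f(A*) − f(A) ). -/
open Finset in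
theorem submodular_union_sub_le_sum {α : Type*} [DecidableEq α] (f : Finset α → ℝ)
    (hmono : ∀ A B : Finset α, A ⊆ B → f A ≤ f B)
    (hsub : ∀ (A B : Finset α) (x : α), A ⊆ B → x ∉ B →
      f (insert x B) - f B ≤ f (insert x A) - f A) (A D : Finset α) :
    f (D ∪ A) - f A ≤ ∑ z ∈ D, (f (insert z A) - f A) := by
  induction D using Finset.induction_on with
  | empty => simp
  | insert x D hx ih =>
    rw [sum_insert hx, insert_union]
    by_cases h : x ∈ D ∪ A
    · rw [insert_eq_of_mem h]
      linarith [hmono A (insert x A) (subset_insert x A)]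
    · linarith [hsub A (D ∪ A) x subset_union_right h]

open Finset in
/-- If `F` dominates `g` at every drawn element, then its total over all draws is at least the
number of draws hitting `D` times the average of `g` over `D`. -/
theorem sum_draws_ge_hits_mul_sum {β : Type*} [Fintype β] [DecidableEq β] (D : Finset β)
    (g : β → ℝ) (s : ℕ) (F : (Fin s → β) → ℝ) (hF : ∀ r, 0 ≤ F r)
    (hFg : ∀ r i, g (r i) ≤ F r) :
    ((Fintype.card β : ℝ) ^ s - ((Fintype.card β : ℝ) - #D) ^ s) * ∑ z ∈ D, g z ≤
      #D * ∑ r, F r := by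
  induction s with
  | zero => simpa using mul_nonneg (Nat.cast_nonneg _) (hF _)
  | succ s ih =>
    have hsplit : ∑ r, F r = ∑ z, ∑ r : Fin s → β, F (Fin.cons z r) := by
      rw [← Fintype.sum_prod_type' (f := fun z (r : Fin s → β) => F (Fin.cons z r))]
      exact (Fintype.sum_equiv (Fin.consEquiv fun _ => β) _ _ fun _ => rfl).symm
    have hmem : (Fintype.card β : ℝ) ^ s * ∑ z ∈ D, g z ≤
        ∑ z ∈ D, ∑ r : Fin s → β, F (Fin.cons z r) := by
      rw [mul_sum]
      refine sum_le_sum fun z _ => ?_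
      calc (Fintype.card β : ℝ) ^ s * g z = ∑ _r : Fin s → β, g z := by simp
        _ ≤ _ := sum_le_sum fun r _ => by simpa using hFg (Fin.cons z r) 0
    have hcompl : (#Dᶜ : ℝ) *
        (((Fintype.card β : ℝ) ^ s - ((Fintype.card β : ℝ) - #D) ^ s) * ∑ z ∈ D, g z) ≤
        #D * ∑ z ∈ Dᶜ, ∑ r : Fin s → β, F (Fin.cons z r) := by
      rw [← nsmul_eq_mul, ← sum_const, mul_sum Dᶜ]
      exact sum_le_sum fun z _ => ih (fun r => F (Fin.cons z r)) (fun r => hF _)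
        fun r i => by simpa using hFg (Fin.cons z r) i.succ
    rw [hsplit, ← sum_add_sum_compl D, mul_add]
    rw [card_compl, Nat.cast_sub (card_le_univ D)] at hcompl
    refine le_trans (le_of_eq ?_)
      (add_le_add (mul_le_mul_of_nonneg_left hmem (Nat.cast_nonneg #D)) hcompl)
    ring

/-- The probability of hitting a set of size `d` in a population of size `m`. -/
theorem hit_probability_ge {d m n k ε : ℝ} (s : ℕ) (hd : 0 < d) (hdm : d ≤ m) (hmn : m ≤ n)
    (hdk : d ≤ k) (hε : 0 < ε) (hs : n / k * Real.log (1 / ε) ≤ s) :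
    (1 - ε) * (d / k) ≤ 1 - (1 - d / m) ^ s := by
  have hm : 0 < m := hd.trans_le hdm
  have hn : 0 < n := hm.trans_le hmn
  have hk : 0 < k := hd.trans_le hdk
  have hbern : ε ^ (d / k) ≤ 1 + d / k * (ε - 1) := by
    simpa using rpow_one_add_le_one_add_mul_self (s := ε - 1) (p := d / k)
      (by linarith) (by positivity) ((div_le_one hk).2 hdk)
  have hpow : (1 - d / m) ^ s ≤ Real.exp (-(d / m)) ^ s :=
    pow_le_pow_left₀ (sub_nonneg.2 ((div_le_one hm).2 hdm)) (Real.one_sub_le_exp_neg _) s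
  have hexp : Real.exp (-(d / m)) ^ s ≤ ε ^ (d / k) := by
    rw [← Real.exp_nat_mul, Real.rpow_def_of_pos hε, Real.exp_le_exp]
    have hlog : d / k * Real.log (1 / ε) ≤ s * (d / m) :=
      calc d / k * Real.log (1 / ε) = n / k * Real.log (1 / ε) * (d / n) := by field_simp
        _ ≤ s * (d / n) := by gcongr
        _ ≤ s * (d / m) := by gcongr
    rw [one_div, Real.log_inv] at hlog
    linarith
  linarith

/-- Single-step guarantee of the stochastic greedy algorithm.  With `f` monotone and
submodular on subsets of a ground set `Z` of size `n`, `A* ⊆ Z` with `|A*| ≤ k`, and a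
current set `A`, draw `s = ⌈(n/k)·ln(1/ε)⌉` elements independently and uniformly (with
replacement) from `Z \ A` and let `x = sel r` be a drawn element maximizing the
marginal gain.  Then `E[f(A ∪ {x}) − f(A)] ≥ ((1−ε)/k)·(f(A*) − f(A))`. -/
theorem stmt11 {α : Type*} [DecidableEq α] (Z : Finset α) (n : ℕ) (hn : Z.card = n)
    (f : Finset α → ℝ)
    (hmono : ∀ A B : Finset α, A ⊆ B → f A ≤ f B)
    (hsub : ∀ (A B : Finset α) (x : α), A ⊆ B → x ∉ B →
      f (insert x B) - f B ≤ f (insert x A) - f A)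
    (k : ℕ) (hk1 : 1 ≤ k) (hkn : k ≤ n)
    (ε : ℝ) (hε0 : 0 < ε) (hε1 : ε < 1)
    (Astar : Finset α) (hAstarZ : Astar ⊆ Z) (hAstark : Astar.card ≤ k)
    (A : Finset α) (hAZ : A ⊆ Z) (hZA : (Z \ A).Nonempty) (hAsA : (Astar \ A).Nonempty)
    (s : ℕ) (hs : s = ⌈(n / k : ℝ) * Real.log (1 / ε)⌉₊)
    (sel : (Fin s → α) → α)
    (hselmem : ∀ r : Fin s → α, (∀ i, r i ∈ Z \ A) → ∃ i, sel r = r i)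
    (hselmax : ∀ r : Fin s → α, (∀ i, r i ∈ Z \ A) →
      ∀ i, f (insert (r i) A) - f A ≤ f (insert (sel r) A) - f A) :
    expDraw s (Z \ A) (fun r => f (insert (sel r) A) - f A) ≥
      ((1 - ε) / k) * (f Astar - f A) := by
  classical
  set S := Z \ A
  set D := Astar \ A
  have hDS : D ⊆ S := Finset.sdiff_subset_sdiff hAstarZ subset_rfl
  have hd : (0 : ℝ) < D.card := by exact_mod_cast hAsA.card_pos
  have hm : (0 : ℝ) < S.card := by exact_mod_cast hZA.card_pos
  have hk : (0 : ℝ) < k := by exact_mod_cast hk1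
  have hprob : (1 - ε) * (D.card / k) ≤ 1 - (1 - (D.card : ℝ) / S.card) ^ s := by
    refine hit_probability_ge (n := n) s hd (by exact_mod_cast Finset.card_le_card hDS) ?_ ?_ hε0
      (hs ▸ Nat.le_ceil _)
    · exact_mod_cast hn ▸ Finset.card_le_card Finset.sdiff_subset
    · exact_mod_cast (Finset.card_le_card Finset.sdiff_subset).trans hAstark
  have hgain : ∀ x, 0 ≤ f (insert x A) - f A := fun x =>
    sub_nonneg.2 (hmono _ _ (Finset.subset_insert x A))
  have hopt : f Astar - f A ≤ ∑ z ∈ D, (f (insert z A) - f A) :=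
    (sub_le_sub_right (hmono _ _ (by simp [D])) _).trans
      (submodular_union_sub_le_sum f hmono hsub A D)
  have hdraws := sum_draws_ge_hits_mul_sum (D.subtype (· ∈ S))
    (fun z : {x // x ∈ S} => f (insert (z : α) A) - f A) s
    (fun r => f (insert (sel fun i => (r i : α)) A) - f A) (fun r => hgain _)
    (fun r i => hselmax (fun i => (r i : α)) (fun i => (r i).2) i)
  rw [Finset.sum_subtype_of_mem (fun z => f (insert z A) - f A) hDS, Finset.card_subtype,
    Finset.filter_true_of_mem hDS, Fintype.card_coe] at hdraws
  unfold expDraw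
  set G := ∑ z ∈ D, (f (insert z A) - f A)
  have hG : 0 ≤ G := Finset.sum_nonneg fun z _ => hgain z
  have hhit : (S.card : ℝ) ^ s - ((S.card : ℝ) - D.card) ^ s =
      (S.card : ℝ) ^ s * (1 - (1 - (D.card : ℝ) / S.card) ^ s) := by
    rw [mul_sub, ← mul_pow, mul_sub, mul_div_cancel₀ _ hm.ne']
    simp
  rw [hhit] at hdraws
  have hε : 0 ≤ (1 - ε) / k := div_nonneg (by linarith) hk.le
  refine (mul_le_mul_of_nonneg_left hopt hε).trans ?_
  rw [le_div_iff₀ (by positivity)]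
  refine le_of_mul_le_mul_left (le_trans ?_ hdraws) hd
  calc (D.card : ℝ) * ((1 - ε) / k * G * (S.card : ℝ) ^ s)
      = (S.card : ℝ) ^ s * ((1 - ε) * (D.card / k)) * G := by ring
    _ ≤ _ := by gcongr
end
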